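/- Let γ = 0.69 and define ω : [0,1] → ℝ by ω(p) = p^γ / (p^γ + (1−p)^γ)^{1/γ} (with ω(0) = 0). Then ω is monotone non-decreasing on [0,1]. -/

import Mathlib

/-- The Tversky–Kahneman weighting function ω(p) = p^γ / (p^γ + (1−p)^γ)^(1/γ)
with γ = 0.69 is monotone non-decreasing on [0,1]. -/
theorem tversky_kahneman_weight_monotone
    (γ : ℝ) (hγ : γ = 0.69)
    (ω : ℝ → ℝ)
    (hω : ∀ p : ℝ, ω p = p ^ γ / (p ^ γ + (1 - p) ^ γ) ^ (1 / γ)) :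
    MonotoneOn ω (Set.Icc (0 : ℝ) 1) := by
  have h0 : 0 < γ := by rw [hγ]; norm_num
  have h1 : γ < 1 := by rw [hγ]; norm_num
  have h2 : 1 - γ ≤ γ := by rw [hγ]; norm_num
  clear hγ
  obtain rfl : ω = fun p : ℝ => p ^ γ / (p ^ γ + (1 - p) ^ γ) ^ (1 / γ) := funext hω
  clear hω
  have hS : ∀ p ∈ Set.Icc (0:ℝ) 1, 0 < p ^ γ + (1 - p) ^ γ := by
    rintro p ⟨ha, hb⟩
    rcases ha.eq_or_lt with rfl | ha
    · simp [Real.zero_rpow h0.ne']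
    · have := Real.rpow_pos_of_pos ha γ
      have := Real.rpow_nonneg (sub_nonneg.2 hb) γ
      linarith
  have hD : ∀ p ∈ Set.Ioo (0:ℝ) 1, HasDerivAt
      (fun p : ℝ => p ^ γ / (p ^ γ + (1 - p) ^ γ) ^ (1 / γ))
      ((1 * γ * p ^ (γ - 1) * (p ^ γ + (1 - p) ^ γ) ^ (1 / γ) - p ^ γ *
        ((1 * γ * p ^ (γ - 1) + (-1) * γ * (1 - p) ^ (γ - 1)) * (1 / γ) *
          (p ^ γ + (1 - p) ^ γ) ^ (1 / γ - 1))) /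
        ((p ^ γ + (1 - p) ^ γ) ^ (1 / γ)) ^ 2) p := by
    rintro p ⟨ha, hb⟩
    have hs := hS p ⟨ha.le, hb.le⟩
    have e1 := (hasDerivAt_id p).rpow_const (p := γ) (Or.inl ha.ne')
    have e2 := ((hasDerivAt_id p).const_sub 1).rpow_const (p := γ)
      (Or.inl (sub_pos.2 hb).ne')
    have e3 := (e1.add e2).rpow_const (p := 1 / γ) (Or.inl hs.ne')
    exact e1.div e3 (Real.rpow_pos_of_pos hs _).ne'
  apply monotoneOn_of_deriv_nonneg (convex_Icc 0 1)
  · apply ContinuousOn.div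
    · exact continuousOn_id.rpow_const (fun _ _ => Or.inr h0.le)
    · apply ContinuousOn.rpow_const
      · exact (continuousOn_id.rpow_const (fun _ _ => Or.inr h0.le)).add
          ((continuousOn_const.sub continuousOn_id).rpow_const (fun _ _ => Or.inr h0.le))
      · exact fun p hp => Or.inl (hS p hp).ne'
    · exact fun p hp => (Real.rpow_pos_of_pos (hS p hp) _).ne'
  · rw [interior_Icc]
    exact fun p hp => (hD p hp).differentiableAt.differentiableWithinAt
  · rw [interior_Icc]
    intro p hp
    rw [(hD p hp).deriv]
    have hs := hS p ⟨hp.1.le, hp.2.le⟩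
    obtain ⟨ha, hb⟩ := hp
    have hq : 0 < 1 - p := sub_pos.2 hb
    apply div_nonneg _ (sq_nonneg _)
    have eS : (p ^ γ + (1 - p) ^ γ) ^ (1 / γ)
        = (p ^ γ + (1 - p) ^ γ) ^ (1 / γ - 1) * (p ^ γ + (1 - p) ^ γ) := by
      rw [← Real.rpow_add_one hs.ne', sub_add_cancel]
    rw [eS]
    have hT := Real.rpow_pos_of_pos hs (1 / γ - 1)
    have ep : p ^ γ = p ^ (γ - 1) * p := by
      rw [← Real.rpow_add_one ha.ne', sub_add_cancel]
    have hA := Real.rpow_pos_of_pos ha (γ - 1)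
    have hB := Real.rpow_pos_of_pos hq (γ - 1)
    have hP := Real.rpow_pos_of_pos ha γ
    have hQ := Real.rpow_pos_of_pos hq γ
    have key : (1 - γ) * p ^ γ ≤ p * (1 - p) ^ (γ - 1) + γ * (1 - p) ^ γ := by
      rcases le_total (1 - p) p with h | h
      · have := Real.rpow_le_rpow_of_nonpos hq h (by linarith : γ - 1 ≤ 0)
        have := mul_le_mul_of_nonneg_left this ha.le
        have := mul_pos h0 hQ
        have := mul_pos h0 hP
        nlinarith
      · have := Real.rpow_le_rpow ha.le h h0.le
        have := mul_le_mul_of_nonneg_left this h0.le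
        have := mul_le_mul_of_nonneg_right h2 hP.le
        have := mul_pos ha hB
        linarith
    generalize (p ^ γ + (1 - p) ^ γ) ^ (1 / γ - 1) = T at *
    generalize p ^ (γ - 1) = A at *
    generalize (1 - p) ^ (γ - 1) = B at *
    generalize (1 - p) ^ γ = Q at *
    rw [ep] at key ⊢
    have : 1 * γ * A * (T * (A * p + Q)) - A * p * ((1 * γ * A + -1 * γ * B) * (1 / γ) * T)
       = A * T * (p * B + γ * Q - (1 - γ) * (A * p)) := by
      field_simp
      ring
    rw [this]
    exact mul_nonneg (mul_pos hA hT).le (sub_nonneg.2 key)
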